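/- Let $d \geq 1$ be an integer and let $h \colon \mathbb{N} \to \mathbb{N}$ be a function such that $h(n) < \tfrac{1}{2d}\log_{16} n$ for all sufficiently large $n$. Let $\alpha \in \mathfrak{S}$, and suppose there exists $n_0$ such that for every $n \geq n_0$ there exists $\beta_n \in \mathfrak{S}$ with $\alpha\,\beta_n \equiv E(u)^{d\,h(n^2)} \pmod{p^n\mathfrak{S}}$. Let $s \geq 0$ be an integer such that for all $n \geq n_0$, whenever $E(u)^x$ divides $\alpha$ in $\mathfrak{S}_n$ one has $x \leq s$. Then for every sufficiently large $n$ there exists $\gamma_n \in \mathfrak{S}$, unique modulo $p^n\mathfrak{S}$, such that $\alpha\,\gamma_n \equiv E(u)^s \pmod{p^n\mathfrak{S}}$. -/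

import Mathlib

open PowerSeries in
/-- The constant `p` stays prime when passing from a domain to its power series ring. -/
theorem prime_natCast_powerSeries {R : Type*} [CommRing R] [IsDomain R] {p : ℕ}
    (hp : Prime (p : R)) : Prime (p : PowerSeries R) := by
  have hC : (p : PowerSeries R) = C (p : R) := by simp
  have : (Ideal.span {(p : R)}).IsPrime := (Ideal.span_singleton_prime hp.ne_zero).2 hp
  have key : ∀ f : PowerSeries R, (p : PowerSeries R) ∣ f ↔
      PowerSeries.map (Ideal.Quotient.mk (Ideal.span {(p : R)})) f = 0 := by
    intro f
    constructor
    · rintro ⟨g, rfl⟩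
      ext n
      rw [hC, coeff_map, coeff_C_mul, map_mul,
        Ideal.Quotient.eq_zero_iff_mem.2 (Ideal.mem_span_singleton_self _), zero_mul, map_zero]
    · intro hf
      have hdvd : ∀ n, (p : R) ∣ coeff n f := by
        intro n
        have hn := congrArg (coeff n) hf
        simpa [Ideal.Quotient.eq_zero_iff_mem, Ideal.mem_span_singleton] using hn
      choose g hg using hdvd
      refine ⟨PowerSeries.mk g, ?_⟩
      ext n
      rw [hC, coeff_C_mul, coeff_mk, hg n]
  refine ⟨?_, ?_, ?_⟩
  · rw [hC]
    exact (map_ne_zero_iff _ C_injective).2 hp.ne_zero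
  · intro hu
    rw [hC] at hu
    have := hu.map (constantCoeff (R := R))
    simp only [constantCoeff_C] at this
    exact hp.not_isUnit this
  · intro a b hab
    rw [key, map_mul, mul_eq_zero] at hab
    simpa [key] using hab

/-- In a domain, an element dividing a power of a prime `q` but not divisible by `q` is a unit. -/
theorem isUnit_of_dvd_prime_pow {R : Type*} [CommRing R] [IsDomain R] {q a : R} (hq : Prime q)
    (ha : ¬ q ∣ a) {m : ℕ} (h : a ∣ q ^ m) : IsUnit a := by
  induction m with
  | zero => exact isUnit_of_dvd_one (by simpa using h)
  | succ m ih =>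
    obtain ⟨z, hz⟩ := h
    have hqz : q ∣ z :=
      (hq.dvd_or_dvd (hz ▸ dvd_pow_self q m.succ_ne_zero : q ∣ a * z)).resolve_left ha
    obtain ⟨w, rfl⟩ := hqz
    refine ih ⟨w, mul_left_cancel₀ hq.ne_zero ?_⟩
    rw [← pow_succ', hz]
    ring

open PowerSeries in
/-- If `S` is a set of power series each of whose members `f` is congruent modulo `F` to `X * f'`
for some `f' ∈ S`, by means of a constant multiple of `F`, then `F` divides every member. -/
theorem powerSeries_dvd_of_forall_exists {R : Type*} [CommRing R] (F : PowerSeries R)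
    (S : Set (PowerSeries R))
    (hS : ∀ f ∈ S, ∃ w : R, ∃ f' ∈ S, f = F * C w + X * f') :
    ∀ f ∈ S, F ∣ f := by
  choose! w f' hf' hf using hS
  let A : PowerSeries R → PowerSeries R := fun f => PowerSeries.mk fun n => w (f'^[n] f)
  have hA : ∀ f, A f = C (w f) + X * A (f' f) := by
    intro f
    ext n
    cases n with
    | zero => simp [A]
    | succ n => simp [A, coeff_succ_X_mul]
  have hdvd : ∀ n, ∀ f ∈ S, (X : PowerSeries R) ^ n ∣ f - F * A f := by
    intro n
    induction n with
    | zero => simp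
    | succ n ih =>
      intro f hfS
      have hstep : f - F * A f = X * (f' f - F * A (f' f)) := by
        rw [hA f]
        linear_combination hf f hfS
      rw [hstep, pow_succ']
      exact mul_dvd_mul_left _ (ih _ (hf' f hfS))
  intro f hfS
  refine ⟨A f, sub_eq_zero.1 ?_⟩
  ext n
  exact X_pow_dvd_iff.1 (hdvd (n + 1) f hfS) n n.lt_succ_self

open PowerSeries in
/-- If every element of `R` not divisible by `p` is a unit, then a power series not divisible by
`X ^ e + p * G`, with `G` invertible, generates together with it an ideal containing
a power of `p`. -/
theorem exists_pow_mem_span_of_not_dvd {R : Type*} [CommRing R] {p : ℕ}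
    (hunit : ∀ w : R, ¬ (p : R) ∣ w → IsUnit w) {e : ℕ} (he : 1 ≤ e) {F G : PowerSeries R}
    (hG : IsUnit G) (hF : F = X ^ e + (p : PowerSeries R) * G) {f : PowerSeries R} (hf : ¬ F ∣ f) :
    ∃ m, (p : PowerSeries R) ^ m ∈ Ideal.span {f, F} := by
  by_contra hcon
  refine hf (powerSeries_dvd_of_forall_exists F
    {f | ¬ ∃ m, (p : PowerSeries R) ^ m ∈ Ideal.span {f, F}} ?_ f hcon)
  intro f hfS
  obtain ⟨e, rfl⟩ := Nat.exists_eq_add_of_le' he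
  obtain ⟨v, hv⟩ := hG.exists_right_inv
  have hp : (p : R) ∣ constantCoeff f := by
    by_contra hnot
    have hfu : IsUnit f := isUnit_iff_constantCoeff.2 (hunit _ hnot)
    refine hfS ⟨0, ?_⟩
    rw [Ideal.eq_top_of_isUnit_mem _ (Ideal.subset_span (Set.mem_insert f {F})) hfu]
    trivial
  obtain ⟨w, hw⟩ := hp
  have hv0 : constantCoeff G * constantCoeff v = 1 := by rw [← map_mul, hv, map_one]
  have hX : (X : PowerSeries R) ∣ f - F * C (constantCoeff v * w) := by
    rw [X_dvd_iff, hF]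
    simp only [map_sub, map_mul, map_add, map_pow, constantCoeff_X, constantCoeff_C, map_natCast,
      hw, zero_pow e.succ_ne_zero]
    linear_combination -(p * w) * hv0
  obtain ⟨f', hf'⟩ := hX
  refine ⟨_, f', ?_, sub_eq_iff_eq_add'.1 hf'⟩
  rintro ⟨m, hm⟩
  obtain ⟨a, b, hab⟩ := Ideal.mem_span_pair.1 hm
  refine hfS ⟨m + 1, Ideal.mem_span_pair.2
    ⟨-(v * X ^ e * a), v * ((p : PowerSeries R) ^ m - b * X ^ (e + 1)) + v * X ^ e * a * C (constantCoeff v * w), ?_⟩⟩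
  linear_combination -v * X ^ e * a * hf' - v * X ^ (e + 1) * hab + v * (p : PowerSeries R) ^ m * hF +
    (p : PowerSeries R) ^ (m + 1) * hv

/-- If `a` and `b` generate an ideal containing `q ^ m`, and `a` divides `b ^ c` modulo `q ^ n` with
`n > m * c`, then `a` divides `q ^ (m * c)`, provided `1` plus any multiple of `q` is invertible. -/
theorem dvd_pow_of_pow_mem_span {R : Type*} [CommRing R] {q a b β : R} {m c n : ℕ}
    (hq : ∀ r, IsUnit (1 - q * r)) (hab : q ^ m ∈ Ideal.span {a, b})
    (hβ : q ^ n ∣ a * β - b ^ c) (hn : m * c < n) : a ∣ q ^ (m * c) := by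
  obtain ⟨x, y, hxy⟩ := Ideal.mem_span_pair.1 hab
  obtain ⟨w, hw⟩ := hβ
  obtain ⟨j, rfl⟩ := Nat.exists_eq_add_of_lt hn
  have hpow : a ∣ q ^ (m * c) - (y * b) ^ c := by
    rw [pow_mul]
    refine dvd_trans ⟨x, ?_⟩ (sub_dvd_pow_sub_pow (q ^ m) (y * b) c)
    linear_combination -hxy
  have hmul : a ∣ q ^ (m * c) * (1 - q * (-(q ^ j * w * y ^ c))) := by
    obtain ⟨z, hz⟩ := hpow
    refine ⟨z + β * y ^ c, ?_⟩
    rw [mul_pow] at hz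
    linear_combination hz - y ^ c * hw
  exact (hq _).dvd_mul_right.1 hmul

/-- If `h n < log₁₆ n / (2 * d)` eventually, then `m * (d * h (n ^ 2)) < n` for arbitrarily large `n`. -/
theorem exists_mul_lt_of_lt_logb {d : ℕ} (hd : 1 ≤ d) {h : ℕ → ℕ}
    (hh : ∃ N, ∀ n ≥ N, (h n : ℝ) < (1 / (2 * (d : ℝ))) * Real.logb 16 n) (m n₀ : ℕ) :
    ∃ n ≥ n₀, m * (d * h (n ^ 2)) < n := by
  obtain ⟨N, hN⟩ := hh
  refine ⟨N + n₀ + m ^ 2 + 1, by omega, ?_⟩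
  set n := N + n₀ + m ^ 2 + 1 with hn
  have hnN : n ^ 2 ≥ N := by nlinarith
  have hdpos : (0 : ℝ) < d := by exact_mod_cast hd
  have hnpos : (0 : ℝ) < n := by rw [hn]; positivity
  have hlog := hN _ hnN
  rw [Nat.cast_pow, Real.logb_pow] at hlog
  have hc : ((d * h (n ^ 2) : ℕ) : ℝ) < Real.logb 16 n := by
    have := mul_lt_mul_of_pos_left hlog hdpos
    push_cast at this ⊢
    calc (d : ℝ) * h (n ^ 2) < d * (1 / (2 * d) * (2 * Real.logb 16 n)) := this
      _ = Real.logb 16 n := by field_simp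
  set c := d * h (n ^ 2)
  rw [Real.lt_logb_iff_rpow_lt (by norm_num) hnpos, Real.rpow_natCast] at hc
  have hc' : 4 ^ c * 4 ^ c < n := by
    rw [← mul_pow]
    exact_mod_cast hc
  have hlt : c < 4 ^ c := Nat.lt_pow_self (by norm_num)
  by_cases hm : m ≤ 4 ^ c
  · exact (Nat.mul_le_mul hm hlt.le).trans_lt hc'
  · have : m * c ≤ m * m := Nat.mul_le_mul_left m (by omega)
    nlinarith

/-- A monic polynomial over a domain, Eisenstein at a prime `p`, has the shape `X ^ e + p * G`
as a power series, where the constant coefficient of `G` is not divisible by `p`. -/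
theorem exists_coe_eq_X_pow_add {R : Type*} [CommRing R] {p e : ℕ} (he : 1 ≤ e)
    {E : Polynomial R} (hmon : E.Monic) (hdeg : E.natDegree = e)
    (heis : ∀ i < e, (p : R) ∣ E.coeff i) (hcon : ¬ ((p : R) ^ 2 ∣ E.coeff 0)) :
    ∃ G : PowerSeries R, ¬ (p : R) ∣ PowerSeries.constantCoeff G ∧
      (E : PowerSeries R) = PowerSeries.X ^ e + (p : PowerSeries R) * G := by
  have hdvd : Polynomial.C (p : R) ∣ E - Polynomial.X ^ e := by
    rw [Polynomial.C_dvd_iff_dvd_coeff]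
    intro i
    rw [Polynomial.coeff_sub, Polynomial.coeff_X_pow]
    rcases lt_trichotomy i e with hi | rfl | hi
    · simpa [hi.ne] using heis i hi
    · have h1 : E.coeff i = 1 := hdeg ▸ hmon.coeff_natDegree
      simp [h1]
    · simp [hi.ne', Polynomial.coeff_eq_zero_of_natDegree_lt (hdeg.trans_lt hi)]
  obtain ⟨g, hg⟩ := hdvd
  rw [sub_eq_iff_eq_add'] at hg
  refine ⟨g, ?_, ?_⟩
  swap
  · rw [hg, Polynomial.coe_add, Polynomial.coe_mul, Polynomial.coe_pow, Polynomial.coe_X,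
      Polynomial.coe_C, map_natCast]
  rintro ⟨w, hw⟩
  refine hcon ⟨w, ?_⟩
  rw [Polynomial.constantCoeff_coe] at hw
  rw [hg, Polynomial.coeff_add, Polynomial.coeff_C_mul, hw, Polynomial.coeff_X_pow,
    if_neg (by omega)]
  ring

/-- Setting as in Statement 0, and suppose moreover `s ≥ 0` is such that for all
`n ≥ n₀`, whenever `E(u)^x` divides `α` in `𝔖ₙ` one has `x ≤ s`. Then for every sufficiently
large `n` there exists `γₙ ∈ 𝔖`, unique modulo `pⁿ𝔖`, with `α γₙ ≡ E(u)^s (mod pⁿ𝔖)`. -/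
theorem stmt6 {p : ℕ} [Fact p.Prime] {k : Type*} [Field k] [CharP k p] [PerfectRing k p]
    (e : ℕ) (he : 1 ≤ e) (E : Polynomial (WittVector p k))
    (hmon : E.Monic) (hdeg : E.natDegree = e)
    (heis : ∀ i < e, (p : WittVector p k) ∣ E.coeff i)
    (hcon : ¬ ((p : WittVector p k) ^ 2 ∣ E.coeff 0))
    (d : ℕ) (hd : 1 ≤ d) (h : ℕ → ℕ)
    (hh : ∃ N, ∀ n ≥ N, (h n : ℝ) < (1 / (2 * (d : ℝ))) * Real.logb 16 n)
    (α : PowerSeries (WittVector p k)) (n₀ : ℕ)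
    (hα : ∀ n ≥ n₀, ∃ β : PowerSeries (WittVector p k),
      (p : PowerSeries (WittVector p k)) ^ n ∣
        α * β - (E : PowerSeries (WittVector p k)) ^ (d * h (n ^ 2)))
    (s : ℕ)
    (hs : ∀ n ≥ n₀, ∀ x : ℕ,
      (∃ θ : PowerSeries (WittVector p k),
        (p : PowerSeries (WittVector p k)) ^ n ∣
          α - (E : PowerSeries (WittVector p k)) ^ x * θ) → x ≤ s) :
    ∃ N, ∀ n ≥ N, ∃ γ : PowerSeries (WittVector p k),
      ((p : PowerSeries (WittVector p k)) ^ n ∣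
        α * γ - (E : PowerSeries (WittVector p k)) ^ s) ∧
      ∀ γ' : PowerSeries (WittVector p k),
        ((p : PowerSeries (WittVector p k)) ^ n ∣
          α * γ' - (E : PowerSeries (WittVector p k)) ^ s) →
        (p : PowerSeries (WittVector p k)) ^ n ∣ γ - γ' := by
  have hpW : Prime (p : WittVector p k) := (WittVector.irreducible p).prime
  have hp := prime_natCast_powerSeries hpW
  have hunit : ∀ w : WittVector p k, ¬ (p : WittVector p k) ∣ w → IsUnit w := fun w hw => by
    refine WittVector.isUnit_of_coeff_zero_ne_zero w fun h0 => hw ?_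
    rw [← Ideal.mem_span_singleton, WittVector.mem_span_p_iff_coeff_zero_eq_zero]
    exact h0
  obtain ⟨G, hG0, hEG⟩ := exists_coe_eq_X_pow_add he hmon hdeg heis hcon
  have hG : IsUnit G := PowerSeries.isUnit_iff_constantCoeff.2 (hunit _ hG0)
  set F : PowerSeries (WittVector p k) := (E : PowerSeries (WittVector p k)) with hF
  have hpF : ¬ (p : PowerSeries (WittVector p k)) ∣ F := by
    rintro ⟨f, hf⟩
    have h1 : PowerSeries.coeff e F = 1 := by
      rw [hF, Polynomial.coeff_coe, ← hdeg, hmon.coeff_natDegree]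
    rw [hf, ← map_natCast PowerSeries.C, PowerSeries.coeff_C_mul] at h1
    exact hpW.not_isUnit (IsUnit.of_mul_eq_one _ h1)
  have hbdd : ∀ x, F ^ x ∣ α → x ≤ s := by
    rintro x ⟨θ, hθ⟩
    exact hs n₀ le_rfl x ⟨θ, by simp [hθ]⟩
  have hfin : FiniteMultiplicity F α :=
    ⟨s, fun hdvd => absurd (hbdd _ hdvd) (by omega)⟩
  obtain ⟨α', hα', hFα'⟩ := hfin.exists_eq_pow_mul_and_not_dvd
  set t := multiplicity F α
  have hts : t ≤ s := hbdd t ⟨α', hα'⟩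
  obtain ⟨m, hm⟩ := exists_pow_mem_span_of_not_dvd hunit he hG hEG hFα'
  obtain ⟨n, hn, hmn⟩ := exists_mul_lt_of_lt_logb hd hh m n₀
  obtain ⟨β, hβ⟩ := hα n hn
  have hpα' : ¬ (p : PowerSeries (WittVector p k)) ∣ α' := by
    intro hdvd
    have hpα : (p : PowerSeries (WittVector p k)) ∣ α * β :=
      (hα' ▸ hdvd.mul_left _ : _ ∣ α).mul_right β
    have hpd := (dvd_pow_self _ (by omega)).trans hβ
    exact hpF (hp.dvd_of_dvd_pow ((dvd_sub_right hpα).1 hpd))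
  have hone : ∀ r : PowerSeries (WittVector p k), IsUnit (1 - p * r) := by
    intro r
    refine PowerSeries.isUnit_iff_constantCoeff.2 (hunit _ fun hdvd => hpW.not_dvd_one ?_)
    simp only [map_sub, map_one, map_mul, map_natCast] at hdvd
    exact (dvd_sub_left (dvd_mul_right _ _)).1 hdvd
  have hα'u : IsUnit α' := by
    refine isUnit_of_dvd_prime_pow hp hpα'
      (dvd_pow_of_pow_mem_span (β := F ^ t * β) hone hm ?_ hmn)
    convert hβ using 2
    rw [hα']
    ring
  have hpα : ¬ (p : PowerSeries (WittVector p k)) ∣ α := by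
    rw [hα']
    exact fun hdvd => (hp.dvd_or_dvd hdvd).elim (fun h' => hpF (hp.dvd_of_dvd_pow h')) hpα'
  obtain ⟨v, hv⟩ := hα'u.exists_right_inv
  have hγ : α * (v * F ^ (s - t)) = F ^ s := by
    calc α * (v * F ^ (s - t)) = (α' * v) * (F ^ t * F ^ (s - t)) := by rw [hα']; ring
      _ = F ^ s := by rw [hv, one_mul, ← pow_add, Nat.add_sub_cancel' hts]
  refine ⟨0, fun n _ => ⟨v * F ^ (s - t), by simp [hγ], fun γ' hγ' => ?_⟩⟩
  rw [← hγ, ← mul_sub] at hγ'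
  rw [← dvd_neg, neg_sub]
  exact hp.pow_dvd_of_dvd_mul_left n hpα hγ'
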